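/- arXiv:1902.06199 — 3 statements merged into one kernel-verified Lean document; each statement's English description precedes it below -/
import Mathlib

section
/- Let n, D be positive integers, let θ : Fin n → EuclideanSpace ℝ (Fin D) be the true parameter vectors, and let γ > 0 be such that for all i₁, i₂, either θ i₁ = θ i₂ or ‖θ i₁ − θ i₂‖ ≥ γ (the γ-gap assumption). Let θ̂ : Fin n → EuclideanSpace ℝ (Fin D) be estimates and B : Fin n → ℝ be confidence bounds such that ‖θ̂ i − θ i‖ ≤ B i and B i < γ/4 for all i. Then for every product i₀, the estimated neighborhood {i : ‖θ̂ i − θ̂ i₀‖ ≤ B i + B i₀} equals the true cluster {i : θ i = θ i₀}. -/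
/-- Lemma EC.6 (hat_N_eq_N): under the γ-gap assumption, if all individual
estimates are within their confidence bounds and all bounds are below γ/4,
the estimated neighborhood of any product equals its true cluster. -/
theorem estimated_neighborhood_eq_true_cluster
    (n D : ℕ) (hn : 0 < n) (hD : 0 < D)
    (θ θhat : Fin n → EuclideanSpace ℝ (Fin D)) (B : Fin n → ℝ) (γ : ℝ)
    (hγ : 0 < γ)
    (hgap : ∀ i₁ i₂ : Fin n, θ i₁ = θ i₂ ∨ γ ≤ ‖θ i₁ - θ i₂‖)
    (hest : ∀ i : Fin n, ‖θhat i - θ i‖ ≤ B i)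
    (hB : ∀ i : Fin n, B i < γ / 4) :
    ∀ i₀ : Fin n,
      {i : Fin n | ‖θhat i - θhat i₀‖ ≤ B i + B i₀} = {i : Fin n | θ i = θ i₀} := by
  intro i₀
  ext i
  simp only [Set.mem_ofPred_eq, ← dist_eq_norm] at *
  constructor
  · intro h
    refine (hgap i i₀).resolve_right fun hfar => ?_
    have htri := dist_triangle4 (θ i) (θhat i) (θhat i₀) (θ i₀)
    rw [dist_comm (θ i) (θhat i)] at htri
    linarith [hest i, hest i₀, hB i, hB i₀]
  · intro h
    have htri := dist_triangle_right (θhat i) (θhat i₀) (θ i₀)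
    have hi := hest i
    rw [h] at hi
    linarith [hest i₀]
end

section
/- Let n, D, m be positive integers, let θ : Fin n → EuclideanSpace ℝ (Fin D) be the true parameter vectors, let C : Fin n → Fin m be a cluster assignment, and let 0 ≤ γ₀ and γ > 2γ₀ be such that for all i₁, i₂: if C i₁ = C i₂ then ‖θ i₁ − θ i₂‖ ≤ γ₀, and if C i₁ ≠ C i₂ then ‖θ i₁ − θ i₂‖ ≥ γ. Let θ̂ : Fin n → EuclideanSpace ℝ (Fin D) be estimates and B : Fin n → ℝ be confidence bounds such that ‖θ̂ i − θ i‖ ≤ B i and B i < γ/8 for all i. Then for every product i₀, the modified estimated neighborhood {i : ‖θ̂ i − θ̂ i₀‖ ≤ B i + B i₀ + γ₀} equals the true cluster {i : C i = C i₀}. -/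
/-- Corollary EC.2: in the relaxed cluster model (within-cluster distance at
most γ₀, between-cluster distance at least γ > 2γ₀), if all estimates are
within their confidence bounds and all bounds are below γ/8, the modified
estimated neighborhood of any product equals its true cluster. -/
theorem modified_estimated_neighborhood_eq_true_cluster
    (n D m : ℕ) (hn : 0 < n) (hD : 0 < D) (hm : 0 < m)
    (θ θhat : Fin n → EuclideanSpace ℝ (Fin D)) (C : Fin n → Fin m)
    (B : Fin n → ℝ) (γ₀ γ : ℝ)
    (hγ₀ : 0 ≤ γ₀) (hγ : 2 * γ₀ < γ)
    (hclose : ∀ i₁ i₂ : Fin n, C i₁ = C i₂ → ‖θ i₁ - θ i₂‖ ≤ γ₀)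
    (hsep : ∀ i₁ i₂ : Fin n, C i₁ ≠ C i₂ → γ ≤ ‖θ i₁ - θ i₂‖)
    (hest : ∀ i : Fin n, ‖θhat i - θ i‖ ≤ B i)
    (hB : ∀ i : Fin n, B i < γ / 8) :
    ∀ i₀ : Fin n,
      {i : Fin n | ‖θhat i - θhat i₀‖ ≤ B i + B i₀ + γ₀} =
        {i : Fin n | C i = C i₀} := by
  intro i₀
  ext i
  simp only [Set.mem_ofPred_eq, ← dist_eq_norm] at *
  have hi := hest i
  have hi₀ := hest i₀
  constructor
  · intro h
    by_contra hne
    have htri := dist_triangle4 (θ i) (θhat i) (θhat i₀) (θ i₀)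
    rw [dist_comm (θ i) (θhat i)] at htri
    linarith [hsep i i₀ hne, hB i, hB i₀]
  · intro h
    have htri := dist_triangle4 (θhat i) (θ i) (θ i₀) (θhat i₀)
    rw [dist_comm (θ i₀) (θhat i₀)] at htri
    linarith [hclose i i₀ h]
end

section
/- Let d be a positive integer, let Σ be a symmetric d×d real matrix such that yᵀΣy ≥ λ₀·‖y‖² for all y ∈ ℝ^d, where λ₀ > 0, let p ∈ ℝ and ω > 0. Then for all y₁, y₃ ∈ ℝ and z ∈ ℝ^d, y₁² + 2·p·y₁·y₃ + (p² + ω)·y₃² + zᵀΣz ≥ (ω·min(1, λ₀)/(1 + p² + ω))·(y₁² + ‖z‖² + y₃²). -/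
open Matrix

/-- The quadratic form of the matrix `!![1, p; p, p ^ 2 + ω]` is bounded below by
determinant over trace. -/
lemma det_div_trace_mul_le_quadratic_form (p a b : ℝ) {ω : ℝ} (hω : 0 < ω) :
    ω / (1 + p ^ 2 + ω) * (a ^ 2 + b ^ 2) ≤
      a ^ 2 + 2 * p * a * b + (p ^ 2 + ω) * b ^ 2 := by
  rw [div_mul_eq_mul_div, div_le_iff₀ (by positivity)]
  linear_combination sq_nonneg (a + p * b) + sq_nonneg (p * a + (p ^ 2 + ω) * b)

/-- Lemma EC.4: quadratic-form lower bound on the full (d+2)×(d+2) conditional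
Fisher information matrix of the extended covariate u = (1, z, p̃ + Δ):
for all (y₁, z, y₃),
y₁² + 2p y₁ y₃ + (p² + ω) y₃² + zᵀSz ≥ (ω·min(1,λ₀)/(1+p²+ω))·(y₁² + ‖z‖² + y₃²),
where S is the conditional covariance matrix of z with λ_min(S) ≥ λ₀. -/
theorem fisher_information_quadratic_form_lower_bound
    (d : ℕ) (hd : 0 < d) (S : Matrix (Fin d) (Fin d) ℝ)
    (hsymm : S.IsSymm) (lam0 : ℝ) (hlam0 : 0 < lam0)
    (hS : ∀ y : Fin d → ℝ, lam0 * ∑ i, y i ^ 2 ≤ y ⬝ᵥ (S *ᵥ y))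
    (p ω : ℝ) (hω : 0 < ω) :
    ∀ (y₁ y₃ : ℝ) (z : Fin d → ℝ),
      ω * min 1 lam0 / (1 + p ^ 2 + ω) * (y₁ ^ 2 + (∑ i, z i ^ 2) + y₃ ^ 2) ≤
        y₁ ^ 2 + 2 * p * y₁ * y₃ + (p ^ 2 + ω) * y₃ ^ 2 + z ⬝ᵥ (S *ᵥ z) := by
  intro y₁ y₃ z
  have hratio : ω / (1 + p ^ 2 + ω) ≤ 1 := by
    rw [div_le_one (by positivity)]
    linarith [sq_nonneg p]
  have hmin : 0 < min 1 lam0 := lt_min one_pos hlam0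
  have hcω : ω * min 1 lam0 / (1 + p ^ 2 + ω) ≤ ω / (1 + p ^ 2 + ω) := by
    rw [mul_div_right_comm]
    exact mul_le_of_le_one_right (by positivity) (min_le_left _ _)
  have hcl : ω * min 1 lam0 / (1 + p ^ 2 + ω) ≤ lam0 := by
    rw [mul_div_right_comm]
    exact (mul_le_of_le_one_left hmin.le hratio).trans (min_le_right _ _)
  have hz : 0 ≤ ∑ i, z i ^ 2 := Finset.sum_nonneg fun i _ => sq_nonneg (z i)
  have hy : 0 ≤ y₁ ^ 2 + y₃ ^ 2 := by positivity
  linarith [det_div_trace_mul_le_quadratic_form p y₁ y₃ hω, hS z,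
    mul_le_mul_of_nonneg_right hcω hy, mul_le_mul_of_nonneg_right hcl hz]
end
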